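/- arXiv:1801.00236 — 4 statements merged into one kernel-verified Lean document; each statement's English description precedes it below -/
import Mathlib

section
/- Let Y and Z be locally compact Hausdorff spaces. Then the normed algebras C₀(Y) and C₀(Z) of continuous complex-valued functions vanishing at infinity are isometrically isomorphic (there exists an algebra isomorphism between them that preserves the supremum norm) if and only if Y and Z are homeomorphic. -/
open Set Topology ZeroAtInfty

namespace ZeroAtInftyContinuousMap

/-- Urysohn's lemma for `C₀(X, ℂ)`. -/
theorem exists_apply_eq_one_of_mem_isOpen {X : Type*} [TopologicalSpace X] [LocallyCompactSpace X]
    [T2Space X] {U : Set X} (hU : IsOpen U) {x : X} (hx : x ∈ U) :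
    ∃ f : C₀(X, ℂ), f x = 1 ∧ ∀ y ∉ U, f y = 0 := by
  obtain ⟨f, hf1, hf0, hfc, -⟩ := exists_continuous_one_zero_of_isCompact
    (isCompact_singleton (x := x)) hU.isClosed_compl
    (by simpa [Set.disjoint_left] using hx)
  refine ⟨⟨⟨fun y => (f y : ℂ), by fun_prop⟩, ?_⟩, ?_, fun y hy => ?_⟩
  · exact (hfc.comp_left (g := fun r : ℝ => (r : ℂ)) (by simp)).is_zero_at_infty
  · simpa using hf1 (mem_singleton x)
  · simpa using hf0 hy

theorem isCompact_setOf_le_norm {X : Type*} [TopologicalSpace X] (f : C₀(X, ℂ)) {ε : ℝ}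
    (hε : 0 < ε) : IsCompact {x | ε ≤ ‖f x‖} := by
  have h : ∀ᶠ x in Filter.cocompact X, ‖f x‖ < ε := by
    have := (zero_at_infty f).norm
    rw [norm_zero] at this
    exact this.eventually_lt_const hε
  obtain ⟨t, ht, hts⟩ := Filter.mem_cocompact.1 h
  refine ht.of_isClosed_subset (isClosed_le continuous_const (map_continuous f).norm) fun x hx => ?_
  by_contra hxt
  exact (show ¬‖f x‖ < ε from not_lt.2 hx) (hts hxt)

/-- The kernel of a nonzero contractive character of `C₀(X, ℂ)` has a common zero. -/
theorem exists_forall_ker_apply_eq_zero {X : Type*} [TopologicalSpace X]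
    (χ : C₀(X, ℂ) →ₙₐ[ℂ] ℂ) (hχ : ∀ f, ‖χ f‖ ≤ ‖f‖) {g : C₀(X, ℂ)} (hg : χ g = 1) :
    ∃ x, ∀ f, χ f = 0 → f x = 0 := by
  by_contra! H
  choose F hF0 hF using H
  have hK := isCompact_setOf_le_norm g (ε := 1 / 2) (by norm_num)
  set K := {x | 1 / 2 ≤ ‖g x‖}
  obtain ⟨t, -, ht⟩ := hK.elim_nhds_subcover (fun x => {y | F x y ≠ 0}) fun x _ =>
    (isOpen_ne_fun (map_continuous (F x)) continuous_const).mem_nhds (hF x)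
  let h : C₀(X, ℂ) := ∑ i ∈ t, star (F i) * F i
  let r : X → ℝ := fun x => ∑ i ∈ t, ‖F i x‖ ^ 2
  have hr : Continuous r := by
    have := fun i => map_continuous (F i)
    fun_prop
  have hr0 : ∀ x, 0 ≤ r x := fun x => Finset.sum_nonneg fun i _ => by positivity
  have hh : ∀ x, h x = r x := by
    intro x
    have : h x = ∑ i ∈ t, (star (F i) * F i) x :=
      map_sum (⟨⟨fun f => f x, rfl⟩, fun _ _ => rfl⟩ : C₀(X, ℂ) →+ ℂ) _ _
    rw [this]
    simp only [r, Complex.ofReal_sum, mul_apply, star_apply]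
    refine Finset.sum_congr rfl fun i _ => ?_
    simpa using Complex.conj_mul' (F i x)
  have hχh : χ h = 0 := by simp [h, map_sum, hF0]
  obtain ⟨m, hm, hmr⟩ : ∃ m, 0 < m ∧ ∀ x ∈ K, m ≤ r x := by
    refine hK.exists_forall_le' hr.continuousOn fun x hx => ?_
    obtain ⟨i, hi, hix⟩ := mem_iUnion₂.1 (ht hx)
    exact Finset.sum_pos' (fun i _ => by positivity) ⟨i, hi, pow_pos (norm_pos_iff.2 hix) 2⟩
  have hmax : ∀ x, 0 < max (r x) m := fun x => lt_max_of_lt_right hm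
  let u : C₀(X, ℂ) := ⟨⟨fun x => g x * ((max (r x) m)⁻¹ : ℝ), by
      exact (map_continuous g).mul (Complex.continuous_ofReal.comp
        ((hr.max continuous_const).inv₀ fun x => (hmax x).ne'))⟩, by
    refine (zero_at_infty g).zero_mul_isBoundedUnder_le ?_
    refine ⟨m⁻¹, Filter.eventually_map.2 (Filter.Eventually.of_forall fun x => ?_)⟩
    simp only [Function.comp, Complex.norm_real, norm_inv, Real.norm_of_nonneg (hmax x).le]
    exact inv_anti₀ hm (le_max_right _ _)⟩
  have hu : ∀ x, u x = g x * ((max (r x) m)⁻¹ : ℝ) := fun _ => rfl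
  have hχk : χ (g - u * h) = 1 := by simp [map_sub, hχh, hg]
  have hle : ‖g - u * h‖ ≤ 1 / 2 := by
    rw [← norm_toBCF_eq_norm, BoundedContinuousFunction.norm_le (by norm_num)]
    intro x
    change ‖g x - u x * h x‖ ≤ 1 / 2
    have he : g x - u x * h x = g x * ((1 - r x / max (r x) m : ℝ) : ℂ) := by
      rw [hu, hh]; push_cast; ring
    rw [he]
    by_cases hx : x ∈ K
    · rw [max_eq_left (hmr x hx), div_self (hm.trans_le (hmr x hx)).ne']
      simp
    · have h1 : r x / max (r x) m ≤ 1 := (div_le_one (hmax x)).2 (le_max_left _ _)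
      have h2 : 0 ≤ r x / max (r x) m := div_nonneg (hr0 x) (hmax x).le
      rw [norm_mul, Complex.norm_real, Real.norm_of_nonneg (by linarith)]
      have h3 : ‖g x‖ < 1 / 2 := not_le.1 hx
      nlinarith [norm_nonneg (g x)]
  have := (hχ (g - u * h)).trans hle
  rw [hχk] at this
  norm_num at this

/-- Every nonzero contractive character of `C₀(X, ℂ)` is the evaluation at a point. -/
theorem exists_character_eq_apply {X : Type*} [TopologicalSpace X] [LocallyCompactSpace X]
    [T2Space X] (χ : C₀(X, ℂ) →ₙₐ[ℂ] ℂ) (hχ : ∀ f, ‖χ f‖ ≤ ‖f‖) (hne : ∃ g, χ g ≠ 0) :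
    ∃ x, ∀ f, χ f = f x := by
  obtain ⟨g₀, hg₀⟩ := hne
  obtain ⟨g, hg⟩ : ∃ g, χ g = 1 := ⟨(χ g₀)⁻¹ • g₀, by simp [hg₀]⟩
  obtain ⟨x, hx⟩ := exists_forall_ker_apply_eq_zero χ hχ hg
  have key : ∀ f, f x = χ f * g x := fun f => by
    have := hx (f - χ f • g) (by simp [map_sub, hg])
    simpa [sub_eq_zero] using this
  obtain ⟨e, he, -⟩ := exists_apply_eq_one_of_mem_isOpen isOpen_univ (mem_univ x)
  have hgx : g x ≠ 0 := fun h0 => by simpa [he, h0] using key e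
  have hgg : g x * g x = g x := by simpa [hg] using key (g * g)
  have hg1 : g x = 1 := mul_left_cancel₀ hgx (by simpa using hgg)
  exact ⟨x, fun f => by simp [key f, hg1]⟩

theorem eq_of_forall_apply_eq {X : Type*} [TopologicalSpace X] [LocallyCompactSpace X]
    [T2Space X] {x y : X} (h : ∀ f : C₀(X, ℂ), f x = f y) : x = y := by
  by_contra hne
  obtain ⟨f, h1, h0⟩ := exists_apply_eq_one_of_mem_isOpen (isOpen_compl_singleton (x := y)) hne
  simpa [h1, h0 y (by simp)] using h f

/-- A surjective contractive homomorphism `C₀(Y, ℂ) → C₀(Z, ℂ)` is composition with a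
continuous map `Z → Y`. -/
theorem exists_continuous_forall_apply_eq {Y Z : Type*} [TopologicalSpace Y]
    [LocallyCompactSpace Y] [T2Space Y] [TopologicalSpace Z] [LocallyCompactSpace Z] [T2Space Z]
    (φ : C₀(Y, ℂ) →ₙₐ[ℂ] C₀(Z, ℂ)) (hφ : ∀ f, ‖φ f‖ ≤ ‖f‖) (hsurj : Function.Surjective φ) :
    ∃ σ : Z → Y, Continuous σ ∧ ∀ f z, φ f z = f (σ z) := by
  have hev : ∀ z, ∃ y, ∀ f, φ f z = f y := fun z => by
    let χ : C₀(Y, ℂ) →ₙₐ[ℂ] ℂ :=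
      { toFun := fun f => φ f z
        map_smul' := fun c f => by simp
        map_zero' := by simp
        map_add' := fun f g => by simp
        map_mul' := fun f g => by simp }
    refine exists_character_eq_apply χ (fun f => ?_) ?_
    · refine le_trans ?_ (hφ f)
      rw [← norm_toBCF_eq_norm]
      exact (φ f).toBCF.norm_coe_le_norm z
    · obtain ⟨e, he, -⟩ := exists_apply_eq_one_of_mem_isOpen isOpen_univ (mem_univ z)
      obtain ⟨g, rfl⟩ := hsurj e
      exact ⟨g, by change φ g z ≠ 0; simp [he]⟩
  choose σ hσ using hev
  refine ⟨σ, continuous_iff_continuousAt.2 fun z => ?_, fun f z => hσ z f⟩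
  refine (nhds_basis_opens (σ z)).ge_iff.2 fun U hU => ?_
  obtain ⟨f, h1, h0⟩ := exists_apply_eq_one_of_mem_isOpen hU.2 hU.1
  have hz : {w | φ f w ≠ 0} ∈ 𝓝 z :=
    (isOpen_ne_fun (map_continuous (φ f)) continuous_const).mem_nhds (by simp [hσ z f, h1])
  refine Filter.mem_map.2 (Filter.mem_of_superset hz fun w hw => ?_)
  by_contra hwU
  exact hw (by rw [hσ w f, h0 _ hwU])

theorem norm_eq_of_comp_equiv {Y Z : Type*} [TopologicalSpace Y] [TopologicalSpace Z]
    {f : C₀(Y, ℂ)} {g : C₀(Z, ℂ)} (e : Z ≃ Y) (h : ∀ z, g z = f (e z)) : ‖g‖ = ‖f‖ := by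
  rw [← norm_toBCF_eq_norm, ← norm_toBCF_eq_norm, BoundedContinuousFunction.norm_eq_iSup_norm,
    BoundedContinuousFunction.norm_eq_iSup_norm, ← e.iSup_comp]
  exact iSup_congr fun z => congrArg norm (h z)

end ZeroAtInftyContinuousMap

open ZeroAtInftyContinuousMap in
/-- Banach–Stone for `C₀`: for locally compact Hausdorff spaces `Y` and `Z`,
the normed algebras `C₀(Y, ℂ)` and `C₀(Z, ℂ)` are isometrically isomorphic if and only if
`Y` and `Z` are homeomorphic. -/
theorem c0_isometricIso_iff_homeomorph (Y Z : Type) [TopologicalSpace Y]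
    [LocallyCompactSpace Y] [T2Space Y] [TopologicalSpace Z]
    [LocallyCompactSpace Z] [T2Space Z] :
    (∃ φ : C₀(Y, ℂ) ≃ C₀(Z, ℂ),
        (∀ f g : C₀(Y, ℂ), φ (f + g) = φ f + φ g) ∧
        (∀ f g : C₀(Y, ℂ), φ (f * g) = φ f * φ g) ∧
        (∀ (c : ℂ) (f : C₀(Y, ℂ)), φ (c • f) = c • φ f) ∧
        (∀ f : C₀(Y, ℂ), ‖φ f‖ = ‖f‖)) ↔ Nonempty (Y ≃ₜ Z) := by
  constructor
  · rintro ⟨φ, hadd, hmul, hsmul, hnorm⟩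
    let Φ : C₀(Y, ℂ) →ₙₐ[ℂ] C₀(Z, ℂ) :=
      { toFun := φ
        map_smul' := hsmul
        map_zero' := by simpa using hsmul 0 0
        map_add' := hadd
        map_mul' := hmul }
    let Ψ : C₀(Z, ℂ) →ₙₐ[ℂ] C₀(Y, ℂ) :=
      { toFun := φ.symm
        map_smul' := fun c f => φ.injective (by simp [hsmul])
        map_zero' := φ.injective (by simpa using (hsmul 0 0).symm)
        map_add' := fun f g => φ.injective (by simp [hadd])
        map_mul' := fun f g => φ.injective (by simp [hmul]) }
    obtain ⟨σ, hσc, hσ⟩ := exists_continuous_forall_apply_eq Φ (fun f => (hnorm f).le) φ.surjective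
    obtain ⟨τ, hτc, hτ⟩ := exists_continuous_forall_apply_eq Ψ
      (fun f => (hnorm (φ.symm f)).symm.le.trans_eq (by rw [φ.apply_symm_apply])) φ.symm.surjective
    have hσ' : ∀ f z, φ f z = f (σ z) := hσ
    have hτ' : ∀ f y, φ.symm f y = f (τ y) := hτ
    exact ⟨{
      toFun := τ
      invFun := σ
      left_inv := fun y => eq_of_forall_apply_eq fun f => by rw [← hσ', ← hτ', φ.symm_apply_apply]
      right_inv := fun z => eq_of_forall_apply_eq fun f => by rw [← hτ', ← hσ', φ.apply_symm_apply]
      continuous_toFun := hτc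
      continuous_invFun := hσc }⟩
  · rintro ⟨e⟩
    let a : CocompactMap Z Y := ⟨⟨e.symm, e.symm.continuous⟩,
      e.symm.isClosedEmbedding.tendsto_cocompact⟩
    let b : CocompactMap Y Z := ⟨⟨e, e.continuous⟩, e.isClosedEmbedding.tendsto_cocompact⟩
    refine ⟨⟨fun f => f.comp a, fun g => g.comp b, fun f => ?_, fun g => ?_⟩, fun _ _ => rfl,
      fun _ _ => rfl, fun _ _ => rfl, fun f => norm_eq_of_comp_equiv e.symm.toEquiv fun _ => rfl⟩
    · ext y
      exact congrArg f (e.symm_apply_apply y)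
    · ext z
      exact congrArg g (e.apply_symm_apply z)
end

section
/- Let X be a completely regular (Hausdorff) topological space and let H be a non-vanishing self-adjoint closed subalgebra of C_B(X) which separates points from closed sets in X. Let α_H X be the compactification of X generated by H (the closure of the image of the evaluation map e : X → ∏_{h∈H} cl_ℂ(h(X))), for h in H let h_α denote the continuous extension of h to α_H X, and let λ_H X = ⋃_{h∈H} Coz(h_α), where Coz(f) denotes the cozero-set of f. Then the map φ : H → C₀(λ_H X) sending h to the restriction of h_α to λ_H X is a norm-preserving algebra isomorphism of H onto C₀(λ_H X); in particular H is isometrically isomorphic to C₀(Y) for the locally compact Hausdorff space Y = λ_H X. -/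
open Set Topology ZeroAtInfty

/-- `H ⊆ C_B(X)` separates points from closed sets in `X`. -/
def SeparatesPointsFromClosedSets {X : Type*} [TopologicalSpace X]
    (H : Set (BoundedContinuousFunction X ℂ)) : Prop :=
  ∀ C : Set X, IsClosed C → ∀ x ∉ C, ∃ h ∈ H, h x ∉ closure ((h : X → ℂ) '' C)

/-- The evaluation map `e : X → ∏_{h ∈ H} cl_ℂ(h(X))`. -/
noncomputable def evalMap {X : Type*} [TopologicalSpace X]
    (H : Set (BoundedContinuousFunction X ℂ)) (x : X) :
    (h : H) → (closure (Set.range ((h : BoundedContinuousFunction X ℂ) : X → ℂ)) : Set ℂ) :=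
  fun h => ⟨(h : BoundedContinuousFunction X ℂ) x, subset_closure ⟨x, rfl⟩⟩

/-- The compactification `α_H X`, as the closure of `e(X)` in the product. -/
noncomputable def alphaSet {X : Type*} [TopologicalSpace X]
    (H : Set (BoundedContinuousFunction X ℂ)) :
    Set ((h : H) → (closure (Set.range ((h : BoundedContinuousFunction X ℂ) : X → ℂ)) : Set ℂ)) :=
  closure (Set.range (evalMap H))

/-- The extension `h_α : α_H X → ℂ` of `h ∈ H`, i.e. the restriction to `α_H X` of the
projection onto the `h`-th coordinate. -/
noncomputable def hAlpha {X : Type*} [TopologicalSpace X]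
    (H : Set (BoundedContinuousFunction X ℂ)) (h : H) (z : alphaSet H) : ℂ :=
  (z.1 h : ℂ)

/-- The subspace `λ_H X = ⋃_{h ∈ H} Coz(h_α)` of `α_H X`. -/
noncomputable def lambdaSet {X : Type*} [TopologicalSpace X]
    (H : Set (BoundedContinuousFunction X ℂ)) : Set (alphaSet H) :=
  {z : alphaSet H | ∃ h : H, hAlpha H h z ≠ 0}

section StoneWeierstrass

variable {Y 𝕜 : Type*} [TopologicalSpace Y] [R1Space Y] [RCLike 𝕜]

/-- The extension by zero of a function vanishing at infinity to the one-point compactification. -/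
noncomputable def ZeroAtInftyContinuousMap.toOnePoint (f : C₀(Y, 𝕜)) : C(OnePoint Y, 𝕜) :=
  OnePoint.continuousMapMk f.toContinuousMap 0
    (by rw [Filter.coclosedCompact_eq_cocompact]; exact f.zero_at_infty')

@[simp]
lemma ZeroAtInftyContinuousMap.toOnePoint_coe (f : C₀(Y, 𝕜)) (y : Y) :
    f.toOnePoint (y : OnePoint Y) = f y := rfl

@[simp]
lemma ZeroAtInftyContinuousMap.toOnePoint_infty (f : C₀(Y, 𝕜)) :
    f.toOnePoint OnePoint.infty = 0 := rfl

/-- The functions on the one-point compactification which, up to a constant, restrict to a member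
of the given subalgebra of `C₀(Y, 𝕜)`. -/
def NonUnitalStarSubalgebra.onePointExtension (A : NonUnitalStarSubalgebra 𝕜 C₀(Y, 𝕜)) :
    StarSubalgebra 𝕜 C(OnePoint Y, 𝕜) where
  carrier := {F | ∃ g ∈ A, ∀ y : Y, g y = F y - F OnePoint.infty}
  mul_mem' := by
    rintro F G ⟨f, hf, hF⟩ ⟨g, hg, hG⟩
    refine ⟨F OnePoint.infty • g + G OnePoint.infty • f + f * g,
      add_mem (add_mem (SMulMemClass.smul_mem _ hg) (SMulMemClass.smul_mem _ hf)) (mul_mem hf hg), fun y => ?_⟩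
    simp [hF, hG]
    ring
  add_mem' := by
    rintro F G ⟨f, hf, hF⟩ ⟨g, hg, hG⟩
    refine ⟨f + g, add_mem hf hg, fun y => ?_⟩
    simp [hF, hG]
    ring
  algebraMap_mem' c := ⟨0, zero_mem A, fun y => by simp⟩
  star_mem' := by
    rintro F ⟨f, hf, hF⟩
    exact ⟨star f, star_mem hf, fun y => by simp [hF]⟩

lemma NonUnitalStarSubalgebra.toOnePoint_mem_onePointExtension
    (A : NonUnitalStarSubalgebra 𝕜 C₀(Y, 𝕜)) {g : C₀(Y, 𝕜)} (hg : g ∈ A) :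
    g.toOnePoint ∈ A.onePointExtension :=
  ⟨g, hg, fun y => by simp⟩

/-- The **Stone-Weierstrass theorem** for functions vanishing at infinity. -/
theorem ZeroAtInftyContinuousMap.dense_of_separatesPoints
    (A : NonUnitalStarSubalgebra 𝕜 C₀(Y, 𝕜))
    (hsep : ∀ x y : Y, x ≠ y → ∃ g ∈ A, g x ≠ g y) (hnv : ∀ y : Y, ∃ g ∈ A, g y ≠ 0) :
    Dense (A : Set C₀(Y, 𝕜)) := by
  have hS : A.onePointExtension.SeparatesPoints := by
    intro x y hxy
    suffices ∃ g ∈ A, g.toOnePoint x ≠ g.toOnePoint y by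
      obtain ⟨g, hg, h⟩ := this
      exact ⟨_, ⟨_, A.toOnePoint_mem_onePointExtension hg, rfl⟩, h⟩
    induction x using OnePoint.rec with
    | infty =>
      induction y using OnePoint.rec with
      | infty => exact absurd rfl hxy
      | coe y => simpa [eq_comm] using hnv y
    | coe x =>
      induction y using OnePoint.rec with
      | infty => simpa using hnv x
      | coe y => simpa using hsep x y (by simpa using hxy)
  have htop :=
    ContinuousMap.starSubalgebra_topologicalClosure_eq_top_of_separatesPoints _ hS
  intro f
  rw [Metric.mem_closure_iff]
  intro ε hε
  have hf : f.toOnePoint ∈ closure (A.onePointExtension : Set C(OnePoint Y, 𝕜)) := by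
    rw [← StarSubalgebra.topologicalClosure_coe, htop]
    trivial
  obtain ⟨G, ⟨g, hg, hG⟩, hd⟩ := Metric.mem_closure_iff.1 hf (ε / 3) (by positivity)
  refine ⟨g, hg, ?_⟩
  rw [← ZeroAtInftyContinuousMap.dist_toBCF_eq_dist]
  refine lt_of_le_of_lt (b := ε / 3 + ε / 3)
    ((BoundedContinuousFunction.dist_le (by positivity)).2 fun y => ?_) (by linarith)
  have h1 := (ContinuousMap.dist_apply_le_dist (f := f.toOnePoint) (g := G) (y : OnePoint Y)).trans
    hd.le
  have h2 := (ContinuousMap.dist_apply_le_dist (f := f.toOnePoint) (g := G) OnePoint.infty).trans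
    hd.le
  rw [dist_eq_norm] at h1 h2
  simp only [toOnePoint_coe, toOnePoint_infty] at h1 h2
  change dist (f y) (g y) ≤ _
  rw [dist_eq_norm, hG]
  calc ‖f y - (G y - G OnePoint.infty)‖ = ‖(f y - G y) - (0 - G OnePoint.infty)‖ := by
        congr 1; ring
    _ ≤ _ := (norm_sub_le _ _).trans (add_le_add h1 h2)

end StoneWeierstrass

section Compactification

variable {X : Type*} [TopologicalSpace X]

lemma continuous_hAlpha (H : Set (BoundedContinuousFunction X ℂ)) (h : H) :
    Continuous (hAlpha H h) :=
  continuous_subtype_val.comp ((continuous_apply h).comp continuous_subtype_val)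

instance compactSpace_alphaSet (H : Set (BoundedContinuousFunction X ℂ)) :
    CompactSpace (alphaSet H) := by
  have (h : H) : CompactSpace
      (closure (Set.range ((h : BoundedContinuousFunction X ℂ) : X → ℂ)) : Set ℂ) :=
    isCompact_iff_compactSpace.1 h.1.isBounded_range.isCompact_closure
  exact isCompact_iff_compactSpace.1 isClosed_closure.isCompact

/-- The embedding of `X` in `α_H X`. -/
noncomputable def toAlpha (H : Set (BoundedContinuousFunction X ℂ)) (x : X) : alphaSet H :=
  ⟨evalMap H x, subset_closure ⟨x, rfl⟩⟩

lemma denseRange_toAlpha (H : Set (BoundedContinuousFunction X ℂ)) :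
    DenseRange (toAlpha H) := by
  intro z
  rw [closure_subtype, ← range_comp]
  exact z.2

lemma norm_hAlpha_le (H : Set (BoundedContinuousFunction X ℂ)) (h : H) (z : alphaSet H) :
    ‖hAlpha H h z‖ ≤ ‖h.1‖ :=
  (denseRange_toAlpha H).induction_on z
    (isClosed_le (continuous_hAlpha H h).norm continuous_const) fun x => h.1.norm_coe_le_norm x

lemma exists_hAlpha_ne (H : Set (BoundedContinuousFunction X ℂ)) {z w : alphaSet H}
    (hzw : z ≠ w) : ∃ h : H, hAlpha H h z ≠ hAlpha H h w := by
  contrapose! hzw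
  exact Subtype.ext (funext fun h => Subtype.ext (hzw h))

/-- The restriction of `h_α` to `λ_H X` vanishes at infinity. -/
noncomputable def hLambda (H : Set (BoundedContinuousFunction X ℂ)) (h : H) :
    C₀(lambdaSet H, ℂ) where
  toFun z := hAlpha H h z.1
  continuous_toFun := (continuous_hAlpha H h).comp continuous_subtype_val
  zero_at_infty' := by
    rw [Metric.tendsto_nhds]
    intro ε hε
    have hK : IsCompact {z : alphaSet H | ε ≤ ‖hAlpha H h z‖} :=
      (isClosed_le continuous_const (continuous_hAlpha H h).norm).isCompact
    have hK' : IsCompact ((↑) ⁻¹' {z : alphaSet H | ε ≤ ‖hAlpha H h z‖} : Set (lambdaSet H)) := by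
      rw [Subtype.isCompact_iff, Subtype.image_preimage_coe, inter_eq_right.2]
      · exact hK
      · exact fun z hz => ⟨h, norm_pos_iff.1 (hε.trans_le hz)⟩
    filter_upwards [hK'.compl_mem_cocompact] with z hz
    simpa using hz

lemma norm_hLambda (H : Set (BoundedContinuousFunction X ℂ))
    (hnv : ∀ x : X, ∃ h ∈ H, h x ≠ 0) (h : H) : ‖hLambda H h‖ = ‖h.1‖ := by
  rw [← ZeroAtInftyContinuousMap.norm_toBCF_eq_norm]
  refine le_antisymm ((BoundedContinuousFunction.norm_le (norm_nonneg _)).2 fun z =>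
    norm_hAlpha_le H h z.1) ((BoundedContinuousFunction.norm_le (norm_nonneg _)).2 fun x => ?_)
  obtain ⟨k, hk, hkx⟩ := hnv x
  exact (hLambda H h).toBCF.norm_coe_le_norm ⟨toAlpha H x, ⟨k, hk⟩, hkx⟩

/-- The map `h ↦ h_α|_{λ_H X}` as a homomorphism of star algebras. -/
noncomputable def lambdaHom (H : NonUnitalStarSubalgebra ℂ (BoundedContinuousFunction X ℂ)) :
    H →⋆ₙₐ[ℂ] C₀(lambdaSet (H : Set (BoundedContinuousFunction X ℂ)), ℂ) where
  toFun h := hLambda (H : Set (BoundedContinuousFunction X ℂ)) ⟨h.1, h.2⟩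
  map_smul' c f := by
    ext z
    exact congrFun ((denseRange_toAlpha (H : Set (BoundedContinuousFunction X ℂ))).equalizer
      (continuous_hAlpha _ ⟨_, (c • f).2⟩)
      (continuous_const.mul (continuous_hAlpha _ ⟨f.1, f.2⟩)) rfl) z.1
  map_zero' := by
    ext z
    exact congrFun ((denseRange_toAlpha (H : Set (BoundedContinuousFunction X ℂ))).equalizer
      (continuous_hAlpha _ ⟨_, (0 : H).2⟩) continuous_const rfl) z.1
  map_add' f g := by
    ext z
    exact congrFun ((denseRange_toAlpha (H : Set (BoundedContinuousFunction X ℂ))).equalizer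
      (continuous_hAlpha _ ⟨_, (f + g).2⟩)
      ((continuous_hAlpha _ ⟨f.1, f.2⟩).add (continuous_hAlpha _ ⟨g.1, g.2⟩)) rfl) z.1
  map_mul' f g := by
    ext z
    exact congrFun ((denseRange_toAlpha (H : Set (BoundedContinuousFunction X ℂ))).equalizer
      (continuous_hAlpha _ ⟨_, (f * g).2⟩)
      ((continuous_hAlpha _ ⟨f.1, f.2⟩).mul (continuous_hAlpha _ ⟨g.1, g.2⟩)) rfl) z.1
  map_star' f := by
    ext z
    exact congrFun ((denseRange_toAlpha (H : Set (BoundedContinuousFunction X ℂ))).equalizer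
      (continuous_hAlpha _ ⟨_, (star f).2⟩)
      (continuous_hAlpha _ ⟨f.1, f.2⟩).star rfl) z.1

lemma lambdaHom_apply (H : NonUnitalStarSubalgebra ℂ (BoundedContinuousFunction X ℂ)) (h : H)
    (z : lambdaSet (H : Set (BoundedContinuousFunction X ℂ))) :
    lambdaHom H h z = hAlpha (H : Set (BoundedContinuousFunction X ℂ)) ⟨h.1, h.2⟩ z.1 := rfl

lemma dense_range_lambdaHom (H : NonUnitalStarSubalgebra ℂ (BoundedContinuousFunction X ℂ)) :
    DenseRange (lambdaHom H) := by
  have := ZeroAtInftyContinuousMap.dense_of_separatesPoints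
    (NonUnitalStarAlgHom.range (lambdaHom H)) (fun z w hzw => ?_) (fun z => ?_)
  · simpa [DenseRange] using this
  · obtain ⟨h, hh⟩ := exists_hAlpha_ne _ (Subtype.coe_injective.ne hzw)
    exact ⟨_, ⟨⟨h.1, h.2⟩, rfl⟩, hh⟩
  · obtain ⟨h, hh⟩ := z.2
    exact ⟨_, ⟨⟨h.1, h.2⟩, rfl⟩, hh⟩

end Compactification

/-- for a completely regular Hausdorff `X` and a non-vanishing self-adjoint
closed subalgebra `H` of `C_B(X)` separating points from closed sets, the map
`φ : H → C₀(λ_H X)`, `h ↦ h_α|_{λ_H X}`, is a norm-preserving algebra isomorphism of `H`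
onto `C₀(λ_H X)`; in particular `H` is isometrically isomorphic to `C₀(Y)` for the
locally compact Hausdorff space `Y = λ_H X`. -/
theorem rep_theorem_isometric_iso {X : Type*} [TopologicalSpace X]
    [CompletelyRegularSpace X] [T2Space X]
    (H : NonUnitalStarSubalgebra ℂ (BoundedContinuousFunction X ℂ))
    (hclosed : IsClosed (H : Set (BoundedContinuousFunction X ℂ)))
    (hnv : ∀ x : X, ∃ h ∈ H, h x ≠ 0)
    (hsep : SeparatesPointsFromClosedSets (H : Set (BoundedContinuousFunction X ℂ))) :
    ∃ φ : H → C₀((lambdaSet (H : Set (BoundedContinuousFunction X ℂ)) : Set _), ℂ),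
      (∀ (h : H) (z : lambdaSet (H : Set (BoundedContinuousFunction X ℂ))),
        φ h z = hAlpha (H : Set (BoundedContinuousFunction X ℂ)) ⟨h.1, h.2⟩ z.1) ∧
      Function.Bijective φ ∧
      (∀ f g : H, φ (f + g) = φ f + φ g) ∧
      (∀ f g : H, φ (f * g) = φ f * φ g) ∧
      (∀ (c : ℂ) (f : H), φ (c • f) = c • φ f) ∧
      (∀ f : H, ‖φ f‖ = ‖(f : BoundedContinuousFunction X ℂ)‖) := by
  have hnorm (f : H) : ‖lambdaHom H f‖ = ‖(f : BoundedContinuousFunction X ℂ)‖ :=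
    norm_hLambda _ hnv ⟨f.1, f.2⟩
  have hiso : Isometry (lambdaHom H) := Isometry.of_dist_eq fun f g => by
    rw [dist_eq_norm, ← map_sub, hnorm, Subtype.dist_eq, dist_eq_norm]
    rfl
  have : CompleteSpace H := hclosed.completeSpace_coe
  have hsurj : Function.Surjective (lambdaHom H) := by
    rw [← range_eq_univ, ← hiso.isClosedEmbedding.isClosed_range.closure_eq]
    exact (dense_range_lambdaHom H).closure_range
  exact ⟨lambdaHom H, lambdaHom_apply H, ⟨hiso.injective, hsurj⟩, map_add _, map_mul _,
    map_smul _, hnorm⟩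
end

section
/- Let X be a topological space and let H = {f ∈ C_B(X) : for every ε > 0 the set |f|⁻¹([ε, ∞)) = {x ∈ X : |f(x)| ≥ ε} is a Lindelöf subspace of X}. Then H is a closed subalgebra of C_B(X): H is closed under addition, multiplication, and scalar multiplication, H is closed under complex conjugation (self-adjoint), and H is a closed subset of C_B(X) in the supremum norm. -/
open Set Topology

/-- If `‖g‖` is dominated pointwise by a multiple of `‖f‖` and the superlevel sets of `‖f‖` are
Lindelöf, then so are those of `‖g‖`. -/
lemma isLindelof_superlevel_of_norm_le_mul {X E F : Type*} [TopologicalSpace X]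
    [SeminormedAddCommGroup E] [SeminormedAddCommGroup F] {f : X → E} {g : X → F}
    (hf : ∀ ε : ℝ, 0 < ε → IsLindelof {x : X | ε ≤ ‖f x‖}) (hg : Continuous g)
    {C : ℝ} (hC : 0 < C) (h : ∀ x, ‖g x‖ ≤ C * ‖f x‖) {ε : ℝ} (hε : 0 < ε) :
    IsLindelof {x : X | ε ≤ ‖g x‖} := by
  refine (hf (ε / C) (div_pos hε hC)).of_isClosed_subset
    (isClosed_le continuous_const hg.norm) fun x hx ↦ ?_
  rw [mem_ofPred_eq, div_le_iff₀' hC]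
  exact le_trans hx (h x)

/-- for a topological space `X`, the set
`H = {f ∈ C_B(X) : {x : |f(x)| ≥ ε} is Lindelöf for every ε > 0}` is a self-adjoint
closed subalgebra of `C_B(X)`: it is closed under addition, multiplication, scalar
multiplication and complex conjugation, and it is a closed subset of `C_B(X)` in the
supremum norm. -/
theorem lindelof_family_closed_subalgebra {X : Type*} [TopologicalSpace X] :
    let H : Set (BoundedContinuousFunction X ℂ) :=
      {f | ∀ ε : ℝ, 0 < ε → IsLindelof {x : X | ε ≤ ‖f x‖}}
    (∀ f ∈ H, ∀ g ∈ H, f + g ∈ H) ∧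
    (∀ f ∈ H, ∀ g ∈ H, f * g ∈ H) ∧
    (∀ (c : ℂ), ∀ f ∈ H, c • f ∈ H) ∧
    (∀ f ∈ H, star f ∈ H) ∧
    IsClosed H := by
  intro H
  refine ⟨fun f hf g hg ε hε ↦ ?_, fun f hf g _ ε hε ↦ ?_, fun c f hf ε hε ↦ ?_,
    fun f hf ε hε ↦ ?_, isClosed_of_closure_subset fun f hf ε hε ↦ ?_⟩
  · refine ((hf (ε / 2) (half_pos hε)).union (hg (ε / 2) (half_pos hε))).of_isClosed_subset
      (isClosed_le continuous_const (f + g).continuous.norm) fun x hx ↦ ?_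
    have hsum : ε ≤ ‖f x‖ + ‖g x‖ := le_trans hx (norm_add_le (f x) (g x))
    by_contra! hlt
    simp only [mem_union, mem_ofPred_eq, not_or, not_le] at hlt
    linarith
  · refine isLindelof_superlevel_of_norm_le_mul hf (f * g).continuous
      (C := ‖g‖ + 1) (by positivity) (fun x ↦ ?_) hε
    rw [BoundedContinuousFunction.mul_apply, norm_mul, mul_comm]
    gcongr
    linarith [g.norm_coe_le_norm x]
  · refine isLindelof_superlevel_of_norm_le_mul hf (c • f).continuous
      (C := ‖c‖ + 1) (by positivity) (fun x ↦ ?_) hε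
    rw [BoundedContinuousFunction.smul_apply, norm_smul]
    gcongr
    linarith
  · exact isLindelof_superlevel_of_norm_le_mul hf (star f).continuous one_pos (fun x ↦ by simp) hε
  · obtain ⟨g, hg, hfg⟩ := Metric.mem_closure_iff.mp hf (ε / 2) (half_pos hε)
    refine (hg (ε / 2) (half_pos hε)).of_isClosed_subset
      (isClosed_le continuous_const f.continuous.norm) fun x hx ↦ ?_
    have hdist : ‖f x - g x‖ < ε / 2 := by
      rw [← dist_eq_norm]
      exact (BoundedContinuousFunction.dist_coe_le_dist x).trans_lt hfg
    have htri := norm_sub_norm_le (f x) (g x)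
    simp only [mem_ofPred_eq] at hx ⊢
    linarith
end

section
/- Let X be a completely regular (Hausdorff) topological space that is locally Lindelöf, meaning every point of X has a neighborhood in X that is Lindelöf as a subspace. Let H = {f ∈ C_B(X) : for every ε > 0 the set {x ∈ X : |f(x)| ≥ ε} is a Lindelöf subspace of X}. Then H is non-vanishing (for every x in X there is h in H with h(x) ≠ 0) and H separates points from closed sets in X: for every closed subspace C of X and every x in X \ C there exists f in H with f(X) ⊆ [0,1], f(x) = 1, and f identically 0 on C (in particular f(x) is not in cl_ℂ(f(C))). -/
open Set Topology

/-- In a completely regular space, a point of an open set `V` contained in a Lindelöf set has a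
bounded continuous bump function with values in `[0, 1]`, vanishing off `V`, whose closed
superlevel sets are Lindelöf. -/
theorem exists_bump_isLindelof_superlevel {X : Type*} [TopologicalSpace X]
    [CompletelyRegularSpace X] {U V : Set X} (hU : IsLindelof U) (hV : IsOpen V) (hVU : V ⊆ U)
    {x : X} (hx : x ∈ V) :
    ∃ f : BoundedContinuousFunction X ℂ,
      (∀ ε : ℝ, 0 < ε → IsLindelof {y : X | ε ≤ ‖f y‖}) ∧
      (∀ y : X, ∃ t : ℝ, 0 ≤ t ∧ t ≤ 1 ∧ f y = (t : ℂ)) ∧ f x = 1 ∧ ∀ y ∉ V, f y = 0 := by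
  obtain ⟨g, hg, hgx, hgV⟩ := CompletelyRegularSpace.completely_regular_isOpen x V hV hx
  have hcont : Continuous fun y => ((1 - (g y : ℝ) : ℝ) : ℂ) := by fun_prop
  let f : BoundedContinuousFunction X ℂ := .ofNormedAddCommGroup _ hcont 1 fun y => by
    rw [Complex.norm_real, Real.norm_eq_abs, abs_of_nonneg (sub_nonneg.2 (g y).2.2)]
    linarith [(g y).2.1]
  have hf : ∀ y, f y = ((1 - (g y : ℝ) : ℝ) : ℂ) := fun _ => rfl
  have hf0 : ∀ y ∉ V, f y = 0 := fun y hy => by simp [hf, hgV hy]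
  refine ⟨f, fun ε hε => ?_, fun y => ?_, by simp [hf, hgx], hf0⟩
  · refine hU.of_isClosed_subset (isClosed_le continuous_const f.continuous.norm) fun y hy => ?_
    by_contra hyU
    have hy' : ε ≤ ‖f y‖ := hy
    rw [hf0 y fun h => hyU (hVU h), norm_zero] at hy'
    exact hy'.not_gt hε
  · exact ⟨1 - g y, sub_nonneg.2 (g y).2.2, by linarith [(g y).2.1], hf y⟩

/-- if `X` is completely regular Hausdorff and locally Lindelöf, then
`H = {f ∈ C_B(X) : {x : |f(x)| ≥ ε} is Lindelöf for every ε > 0}` is non-vanishing and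
separates points from closed sets: for every closed `C ⊆ X` and `x ∉ C` there is
`f ∈ H` with values in `[0, 1]`, `f(x) = 1` and `f ≡ 0` on `C` (in particular
`f(x) ∉ cl_ℂ(f(C))`). -/
theorem lindelof_family_nonvanishing_separates {X : Type*} [TopologicalSpace X]
    [CompletelyRegularSpace X] [T2Space X]
    (hloc : ∀ x : X, ∃ U ∈ nhds x, IsLindelof U) :
    let H : Set (BoundedContinuousFunction X ℂ) :=
      {f | ∀ ε : ℝ, 0 < ε → IsLindelof {x : X | ε ≤ ‖f x‖}}
    (∀ x : X, ∃ h ∈ H, h x ≠ 0) ∧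
    ∀ C : Set X, IsClosed C → ∀ x ∉ C, ∃ f ∈ H,
      (∀ y : X, ∃ t : ℝ, 0 ≤ t ∧ t ≤ 1 ∧ f y = (t : ℂ)) ∧
      f x = 1 ∧ (∀ c ∈ C, f c = 0) ∧
      f x ∉ closure ((f : X → ℂ) '' C) := by
  intro H
  have key : ∀ C : Set X, IsClosed C → ∀ x ∉ C, ∃ f ∈ H,
      (∀ y : X, ∃ t : ℝ, 0 ≤ t ∧ t ≤ 1 ∧ f y = (t : ℂ)) ∧
      f x = 1 ∧ (∀ c ∈ C, f c = 0) ∧ f x ∉ closure ((f : X → ℂ) '' C) := by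
    intro C hC x hx
    obtain ⟨U, hUx, hU⟩ := hloc x
    obtain ⟨f, hfH, hfI, hfx, hf0⟩ := exists_bump_isLindelof_superlevel hU
      (isOpen_interior.inter hC.isOpen_compl) (inter_subset_left.trans interior_subset)
      ⟨mem_interior_iff_mem_nhds.2 hUx, hx⟩
    have hfC : ∀ c ∈ C, f c = 0 := fun c hc => hf0 c fun h => h.2 hc
    refine ⟨f, hfH, hfI, hfx, hfC, fun hmem => ?_⟩
    have hsub : (f : X → ℂ) '' C ⊆ {0} := by
      rintro _ ⟨c, hc, rfl⟩
      exact hfC c hc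
    have h0 : f x = 0 := closure_minimal hsub isClosed_singleton hmem
    exact one_ne_zero (hfx.symm.trans h0)
  refine ⟨fun x => ?_, key⟩
  obtain ⟨f, hfH, -, hfx, -⟩ := key ∅ isClosed_empty x (notMem_empty x)
  exact ⟨f, hfH, hfx ▸ one_ne_zero⟩
end
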